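/- There exists a subset T ⊆ {2, 3, 4, …} such that the function r_T : ℕ → ℕ, where r_T(k) is the number of ~_T-equivalence classes of words of length k, is not a computable function. -/

import Mathlib

/-- The letter `L`, as a one-letter word in the free monoid on the two letters
`{L, R}` (encoded as `Bool`, with `L = false` and `R = true`). -/
def Lw : FreeMonoid Bool := FreeMonoid.of false

/-- The letter `R`, as a one-letter word in the free monoid on `{L, R}`. -/
def Rw : FreeMonoid Bool := FreeMonoid.of true

/-- The word `w_n = (LR)^n LL`. -/
def wWord (n : ℕ) : FreeMonoid Bool := (Lw * Rw) ^ n * (Lw * Lw)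

/-- The word `v_n = RR L^(2n−2) RL`. -/
def vWord (n : ℕ) : FreeMonoid Bool := Rw * Rw * Lw ^ (2 * n - 2) * (Rw * Lw)

/-- The generating relation identifying `w_n` with `v_n` for all `n ∈ T`. -/
def sternRel (T : Set ℕ) : FreeMonoid Bool → FreeMonoid Bool → Prop :=
  fun u v => ∃ n ∈ T, u = wWord n ∧ v = vWord n

/-- `~_T`: the smallest monoid congruence on `{L,R}*` containing the pairs
`(w_n, v_n)` for all `n ∈ T`. -/
def sternCon (T : Set ℕ) : Con (FreeMonoid Bool) := conGen (sternRel T)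
/-- The number of `~_T`-equivalence classes of words of length `k`, i.e. the cardinality
of the `k`-th rank level of the poset associated to `M_T`. -/
noncomputable def classCount (T : Set ℕ) (k : ℕ) : ℕ :=
  Nat.card {q : (sternCon T).Quotient //
    ∃ w : FreeMonoid Bool, w.length = k ∧ (w : (sternCon T).Quotient) = q}

theorem vWord_getElem? {n : ℕ} (hn : 2 ≤ n) (j : ℕ) :
    (vWord n).toList[j]? =
      if j < 2 ∨ j = 2 * n then some true else if j < 2 * n + 2 then some false else none := by
  have h : (vWord n).toList = [true, true] ++ List.replicate (2 * n - 2) false ++ [true, false] := by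
    have hp : ∀ m : ℕ, (Lw ^ m).toList = List.replicate m false := by
      intro m
      induction m with
      | zero => rfl
      | succ m ih => rw [pow_succ', FreeMonoid.toList_mul, ih]; rfl
    simp only [vWord, FreeMonoid.toList_mul, hp]
    rfl
  rw [h]
  simp only [List.getElem?_append, List.length_append, List.length_replicate, List.length_cons,
    List.length_nil, List.getElem?_replicate]
  rcases lt_or_ge j 2 with h2 | h2
  · interval_cases j <;> grind
  rcases lt_or_ge j (2 * n) with h3 | h3
  · have : j - 2 < 2 * n - 2 := by omega
    grind
  obtain ⟨i, rfl⟩ := Nat.exists_eq_add_of_le h3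
  have e : 2 * n + i - (0 + 1 + 1 + (2 * n - 2)) = i := by omega
  rw [e]
  rcases i with _ | _ | i <;> grind

theorem wWord_getElem? {k : ℕ} (hk : 2 ≤ k) :
    (wWord k).toList[1]? = some true ∧ (wWord k).toList[2]? = some false ∧
      (wWord k).toList[3]? = some true := by
  obtain ⟨m, rfl⟩ := Nat.exists_eq_add_of_le hk
  have h : (wWord (2 + m)).toList =
      [false, true, false, true] ++ ((Lw * Rw) ^ m * (Lw * Lw)).toList := by
    rw [wWord, pow_add, mul_assoc, FreeMonoid.toList_mul]
    rfl
  simp [h]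

theorem length_vWord {n : ℕ} (hn : 2 ≤ n) : (vWord n).length = 2 * n + 2 := by
  have hp : ∀ m : ℕ, (Lw ^ m).length = m := by
    intro m
    induction m with
    | zero => rfl
    | succ m ih => rw [pow_succ, FreeMonoid.length_mul, ih]; rfl
  have h1 : Lw.length = 1 := rfl
  have h2 : Rw.length = 1 := rfl
  simp only [vWord, FreeMonoid.length_mul, hp, h1, h2]
  omega

theorem length_wWord (n : ℕ) : (wWord n).length = 2 * n + 2 := by
  have hp : ∀ m : ℕ, ((Lw * Rw) ^ m).length = 2 * m := by
    intro m
    induction m with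
    | zero => rfl
    | succ m ih => rw [pow_succ, FreeMonoid.length_mul, ih]; rfl
  rw [wWord, FreeMonoid.length_mul, hp]
  rfl

theorem getElem?_of_mul_mul_eq {a u b v : FreeMonoid Bool} (h : a * u * b = v) {j : ℕ} {c : Bool}
    (hj : u.toList[j]? = some c) : v.toList[a.toList.length + j]? = some c := by
  rw [← h, FreeMonoid.toList_mul, FreeMonoid.toList_mul, List.append_assoc,
    List.getElem?_append_right (Nat.le_add_right _ _), Nat.add_sub_cancel_left,
    List.getElem?_append_left (List.getElem?_eq_some_iff.mp hj).1, hj]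

/-- `w_k` is never a factor of `v_n`, since `RLR` is not. -/
theorem mul_wWord_mul_ne_vWord {n k : ℕ} (hn : 2 ≤ n) (hk : 2 ≤ k) (a b : FreeMonoid Bool) :
    a * wWord k * b ≠ vWord n := by
  intro h
  obtain ⟨h1, h2, h3⟩ := wWord_getElem? hk
  replace h1 := getElem?_of_mul_mul_eq h h1
  replace h2 := getElem?_of_mul_mul_eq h h2
  replace h3 := getElem?_of_mul_mul_eq h h3
  rw [vWord_getElem? hn] at h1 h2 h3
  grind

/-- `v_k` is a factor of `v_n` only if `k = n`. -/
theorem mul_vWord_mul_ne_vWord {n k : ℕ} (hn : 2 ≤ n) (hk : 2 ≤ k) (hkn : k ≠ n)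
    (a b : FreeMonoid Bool) : a * vWord k * b ≠ vWord n := by
  intro h
  have key : ∀ j c, (vWord k).toList[j]? = some c → _ := fun j c => getElem?_of_mul_mul_eq h
  have h0 := key 0 true (by simp [vWord_getElem? hk])
  have h1 := key 1 true (by simp [vWord_getElem? hk])
  have h2 := key (2 * k) true (by simp [vWord_getElem? hk])
  rw [vWord_getElem? hn] at h0 h1 h2
  grind

/-- The syntactic congruence of the singleton `{v}`. -/
def singletonSyntacticCon (v : FreeMonoid Bool) : Con (FreeMonoid Bool) where
  r x y := ∀ a b, a * x * b = v ↔ a * y * b = v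
  iseqv := ⟨fun _ _ _ => Iff.rfl, fun h a b => (h a b).symm,
    fun h h' a b => (h a b).trans (h' a b)⟩
  mul' {w x y z} h h' a b := by
    have e1 := h a (y * b)
    have e2 := h' (a * x) b
    simp only [mul_assoc] at e1 e2 ⊢
    exact e1.trans e2

/-- If `n ∉ S`, the `~_S`-class of `v_n` is a singleton. -/
theorem eq_vWord_of_sternCon {S : Set ℕ} (hS : ∀ k ∈ S, 2 ≤ k) {n : ℕ} (hn : 2 ≤ n) (hnS : n ∉ S)
    {x : FreeMonoid Bool} (h : sternCon S (vWord n) x) : x = vWord n := by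
  have hle : sternCon S ≤ singletonSyntacticCon (vWord n) := by
    refine Con.conGen_le.mpr ?_
    rintro _ _ ⟨k, hk, rfl, rfl⟩ a b
    exact iff_of_false (mul_wWord_mul_ne_vWord hn (hS k hk) a b)
      (mul_vWord_mul_ne_vWord hn (hS k hk) (fun e => hnS (e ▸ hk)) a b)
  simpa using hle h 1 1

/-- The congruence of equality of length together with `c` on words of length at most `N`. -/
def truncatedCon (c : Con (FreeMonoid Bool)) (N : ℕ) : Con (FreeMonoid Bool) where
  r x y := x.length = y.length ∧ (x.length ≤ N → c x y)
  iseqv := ⟨fun x => ⟨rfl, fun _ => c.refl x⟩,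
    fun h => ⟨h.1.symm, fun hl => c.symm (h.2 (h.1 ▸ hl))⟩,
    fun h h' => ⟨h.1.trans h'.1, fun hl => c.trans (h.2 hl) (h'.2 (h.1 ▸ hl))⟩⟩
  mul' {w x y z} h h' := by
    refine ⟨by simp only [FreeMonoid.length_mul, h.1, h'.1], fun hl => ?_⟩
    rw [FreeMonoid.length_mul] at hl
    exact c.mul (h.2 (by omega)) (h'.2 (by omega))

theorem sternCon_le_truncatedCon {S T : Set ℕ} (hS : ∀ k ∈ S, 2 ≤ k) {N : ℕ}
    (hST : ∀ k ∈ S, 2 * k + 2 ≤ N → k ∈ T) : sternCon S ≤ truncatedCon (sternCon T) N := by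
  refine Con.conGen_le.mpr ?_
  rintro _ _ ⟨k, hk, rfl, rfl⟩
  refine ⟨by rw [length_wWord, length_vWord (hS k hk)], fun hl => ?_⟩
  rw [length_wWord] at hl
  exact ConGen.Rel.of _ _ ⟨k, hST k hk hl, rfl, rfl⟩

theorem classCount_lt_classCount {S T : Set ℕ} (hS : ∀ k ∈ S, 2 ≤ k) {n : ℕ} (hn : 2 ≤ n)
    (hnS : n ∉ S) (hnT : n ∈ T) (hST : ∀ k < n, k ∈ S → k ∈ T) :
    classCount T (2 * n + 2) < classCount S (2 * n + 2) := by
  have hle := sternCon_le_truncatedCon (T := T) (N := 2 * n + 2) hS fun k hk hl =>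
    hST k (lt_of_le_of_ne (by omega) fun e => hnS (e ▸ hk)) hk
  let W := {w : FreeMonoid Bool // w.length = 2 * n + 2}
  have : Finite W := (List.finite_length_eq Bool (2 * n + 2)).to_subtype
  let C (U : Set ℕ) := {q : (sternCon U).Quotient //
    ∃ w : FreeMonoid Bool, w.length = 2 * n + 2 ∧ (w : (sternCon U).Quotient) = q}
  let p (U : Set ℕ) (w : W) : C U := ⟨(w.1 : (sternCon U).Quotient), w.1, w.2, rfl⟩
  have hp (U : Set ℕ) : Function.Surjective (p U) := by
    rintro ⟨_, w, hw, rfl⟩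
    exact ⟨⟨w, hw⟩, rfl⟩
  have hpeq (U : Set ℕ) (x y : W) : p U x = p U y ↔ sternCon U x.1 y.1 := by
    rw [Subtype.ext_iff]
    exact Con.eq _
  have : Finite (C S) := Finite.of_surjective _ (hp S)
  have hST' (x y : W) (h : p S x = p S y) : p T x = p T y :=
    (hpeq T x y).mpr ((hle ((hpeq S x y).mp h)).2 x.2.le)
  let g : C T → C S := fun q => p S (Function.surjInv (hp T) q)
  have hg (x : W) (q : C T) (h : g q = p S x) : q = p T x := by
    exact (Function.surjInv_eq (hp T) q).symm.trans (hST' _ _ h)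
  have hginj : Function.Injective g := fun x y hxy =>
    (hg _ x hxy).trans (Function.surjInv_eq (hp T) y)
  let wn : W := ⟨wWord n, length_wWord n⟩
  let vn : W := ⟨vWord n, length_vWord hn⟩
  have hwv : p T wn = p T vn := (hpeq T _ _).mpr (ConGen.Rel.of _ _ ⟨n, hnT, rfl, rfl⟩)
  have hne : p S vn ≠ p S wn := fun e =>
    mul_wWord_mul_ne_vWord hn hn 1 1
      (by simpa using eq_vWord_of_sternCon hS hn hnS ((hpeq S vn wn).mp e))
  refine lt_of_not_ge fun hcard => hne ?_
  have hsurj : Function.Surjective g :=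
    (hginj.bijective_of_nat_card_le hcard).2
  obtain ⟨a, ha⟩ := hsurj (p S vn)
  obtain ⟨b, hb⟩ := hsurj (p S wn)
  rw [← ha, ← hb, hg _ _ ha, hg _ _ hb, hwv]

theorem classCount_injOn : Set.InjOn classCount {T : Set ℕ | ∀ k ∈ T, 2 ≤ k} := by
  intro S hS T hT h
  by_contra hne
  have hex : ∃ n, ¬ (n ∈ S ↔ n ∈ T) := by
    by_contra! hc
    exact hne (Set.ext hc)
  classical
  have hmin := fun k => Nat.find_min (m := k) hex
  have hspec := Nat.find_spec hex
  generalize Nat.find hex = n at hmin hspec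
  have hc := congrFun h (2 * n + 2)
  by_cases hnS : n ∈ S
  · have hnT : n ∉ T := by tauto
    exact (classCount_lt_classCount hT (hS n hnS) hnT hnS
      fun k hk hkT => (not_not.mp (hmin k hk)).mpr hkT).ne hc
  · have hnT : n ∈ T := by tauto
    exact (classCount_lt_classCount hS (hT n hnT) hnS hnT
      fun k hk hkS => (not_not.mp (hmin k hk)).mp hkS).ne' hc

theorem countable_computable : {f : ℕ → ℕ | Computable f}.Countable := by
  have hcode : ∀ f : {f : ℕ → ℕ // Computable f},
      ∃ c : Nat.Partrec.Code, c.eval = fun k => Part.some (f.1 k) := fun f =>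
    Nat.Partrec.Code.exists_code.mp (Partrec.nat_iff.mp f.2)
  choose c hc using hcode
  refine Function.Injective.countable (f := c) fun f g h => Subtype.ext (funext fun k => ?_)
  have := congrFun ((hc f).symm.trans ((congrArg _ h).trans (hc g))) k
  exact Part.some_injective this

/-- There exists a subset `T ⊆ {2, 3, 4, …}` such that the function `r_T : ℕ → ℕ`, where
`r_T(k)` is the number of `~_T`-equivalence classes of words of length `k`, is not a
computable function. -/
theorem exists_uncomputable_classCount :
    ∃ T : Set ℕ, (∀ n ∈ T, 2 ≤ n) ∧ ¬ Computable (fun k => classCount T k) := by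
  by_contra! hc
  have hmem : ∀ A : Set ℕ, ∀ k ∈ (· + 2) '' A, 2 ≤ k := by
    rintro A _ ⟨m, -, rfl⟩
    exact Nat.le_add_left _ _
  have := countable_computable.to_subtype
  let F : Set ℕ → {f : ℕ → ℕ | Computable f} := fun A =>
    ⟨classCount ((· + 2) '' A), hc _ (hmem A)⟩
  have hF : Function.Injective F := fun A B h =>
    (add_left_injective 2).image_injective
      (classCount_injOn (hmem A) (hmem B) (congrArg Subtype.val h))
  obtain ⟨e, he⟩ := exists_injective_nat {f : ℕ → ℕ | Computable f}
  exact Function.cantor_injective _ (he.comp hF)
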